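/- arXiv:2010.10689 — 5 statements merged into one kernel-verified Lean document; each statement's English description precedes it below -/
import Mathlib

section
/- For every real number x that is not an integer, there exists a constant C > 0 (depending only on x) such that for every positive integer q with q > 2π|x| one has |c_q(x) − ((e^{2πix} − 1)/(2πix))·φ(q)| ≤ C·σ_0(q). -/
open Finset

/-- The real-variable Ramanujan sum `c_q(x) = ∑_{1 ≤ k ≤ q, gcd(k,q)=1} e^{2πikx/q}`. -/
noncomputable def cq (q : ℕ) (x : ℝ) : ℂ :=
  ∑ k ∈ (Finset.Icc 1 q).filter (fun k => Nat.gcd k q = 1),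
    Complex.exp (2 * (Real.pi : ℂ) * Complex.I * (k : ℂ) * (x : ℂ) / (q : ℂ))

/-- The Riemann zeta function of a real argument `s > 1`, as the series `∑_{n≥1} n^{-s}`. -/
noncomputable def zetaR (s : ℝ) : ℝ := ∑' n : ℕ, 1 / (n + 1 : ℝ) ^ s

/-- The sum of the Möbius function over the divisors of a natural number. -/
lemma sum_divisors_moebius_eq_ite (n : ℕ) :
    ∑ d ∈ n.divisors, (ArithmeticFunction.moebius d : ℂ) = if n = 1 then 1 else 0 := by
  have h := congrArg (fun f : ArithmeticFunction ℤ => f n)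
    ArithmeticFunction.moebius_mul_coe_zeta
  simp only [ArithmeticFunction.coe_mul_zeta_apply,
    ArithmeticFunction.one_apply] at h
  exact_mod_cast h

/-- Möbius inversion for a sum over residues coprime to `q`. -/
lemma sum_coprime_eq_sum_moebius {q : ℕ} (hq : 0 < q) (g : ℕ → ℂ) :
    ∑ k ∈ (Icc 1 q).filter (fun k => Nat.gcd k q = 1), g k =
      ∑ d ∈ q.divisors, (ArithmeticFunction.moebius d : ℂ) *
        ∑ j ∈ Icc 1 (q / d), g (d * j) := by
  have hinner : ∀ d ∈ q.divisors,
      ∑ j ∈ Icc 1 (q / d), g (d * j) = ∑ k ∈ (Icc 1 q).filter (fun k => d ∣ k), g k := by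
    intro d hd
    have hdpos : 0 < d := Nat.pos_of_mem_divisors hd
    refine Finset.sum_bij (fun j _ => d * j) ?_ ?_ ?_ (fun _ _ => rfl)
    · intro j hj
      rw [mem_Icc] at hj
      rw [mem_filter, mem_Icc]
      refine ⟨⟨Nat.mul_pos hdpos hj.1, ?_⟩, dvd_mul_right d j⟩
      exact (Nat.mul_le_mul_left d hj.2).trans (Nat.mul_div_le q d)
    · intro a _ b _ hab
      exact Nat.eq_of_mul_eq_mul_left hdpos hab
    · intro k hk
      rw [mem_filter, mem_Icc] at hk
      obtain ⟨⟨hk1, hkq⟩, j, rfl⟩ := hk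
      refine ⟨j, ?_, rfl⟩
      rw [mem_Icc]
      exact ⟨Nat.pos_of_mul_pos_left hk1, (Nat.le_div_iff_mul_le hdpos).2 (by linarith)⟩
  rw [Finset.sum_congr (s₁ := q.divisors) rfl fun d hd => by rw [hinner d hd]]
  simp_rw [Finset.sum_filter, Finset.mul_sum]
  rw [Finset.sum_comm]
  refine Finset.sum_congr rfl fun k _ => ?_
  have hdiv : (Nat.gcd k q).divisors = q.divisors.filter (fun d => d ∣ k) := by
    ext d
    simp only [Nat.mem_divisors, mem_filter, Nat.dvd_gcd_iff]
    have hq0 := hq.ne'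
    have hgcd : Nat.gcd k q ≠ 0 := (Nat.gcd_pos_of_pos_right k hq).ne'
    tauto
  have hsum := sum_divisors_moebius_eq_ite (Nat.gcd k q)
  rw [hdiv, Finset.sum_filter] at hsum
  calc (if Nat.gcd k q = 1 then g k else 0)
      = (if Nat.gcd k q = 1 then 1 else 0) * g k := by split_ifs <;> simp
    _ = _ := by
      rw [← hsum, Finset.sum_mul]
      refine Finset.sum_congr rfl fun d _ => ?_
      split_ifs <;> simp

/-- A second-order Taylor bound for `exp` on the imaginary axis. -/
lemma norm_exp_I_mul_sub_one_sub_le (θ : ℝ) :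
    ‖Complex.exp (Complex.I * θ) - 1 - Complex.I * θ‖ ≤ 2 * θ ^ 2 := by
  have hnorm : ‖Complex.I * (θ : ℂ)‖ = |θ| := by simp
  rcases le_total |θ| 1 with h | h
  · have := Complex.norm_exp_sub_one_sub_id_le (x := Complex.I * θ) (by rwa [hnorm])
    rw [hnorm, sq_abs] at this
    nlinarith [sq_nonneg θ]
  · have h1 : ‖Complex.exp (Complex.I * θ) - 1‖ ≤ |θ| := by
      simpa using Real.norm_exp_I_mul_ofReal_sub_one_le (x := θ)
    calc _ ≤ ‖Complex.exp (Complex.I * θ) - 1‖ + ‖Complex.I * (θ : ℂ)‖ := norm_sub_le _ _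
      _ ≤ |θ| + |θ| := by rw [hnorm]; gcongr
      _ ≤ 2 * θ ^ 2 := by rw [← sq_abs]; nlinarith

/-- The right Riemann sum of `t ↦ exp (i α t)` on `[0, 1]` with `m` nodes approximates the
integral with error `O(1 / m)`. -/
lemma norm_sum_exp_sub_mean_le {α : ℝ} (hα : α ≠ 0) {m : ℕ} (hm : 0 < m) :
    ‖∑ j ∈ Icc 1 m, (Complex.exp (Complex.I * (α / m : ℝ)) ^ j -
        (Complex.exp (Complex.I * α) - 1) / (Complex.I * α))‖ ≤ 2 * |α| := by
  set θ : ℝ := α / m with hθ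
  set w := Complex.exp (Complex.I * θ) with hw
  have hmR : (0 : ℝ) < m := by exact_mod_cast hm
  have hmC : (m : ℂ) ≠ 0 := by exact_mod_cast hm.ne'
  have hαθ : α = m * θ := by rw [hθ]; field_simp
  have hθ0 : θ ≠ 0 := div_ne_zero hα hmR.ne'
  have hθC : (θ : ℂ) ≠ 0 := by exact_mod_cast hθ0
  have hwm : Complex.exp (Complex.I * α) = w ^ m := by
    rw [hw, ← Complex.exp_nat_mul, hαθ]
    push_cast
    ring_nf
  have hw1 : ‖w‖ = 1 := by rw [hw, mul_comm, Complex.norm_exp_ofReal_mul_I]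
  have htel : w ^ m - 1 = ∑ i ∈ range m, (w ^ (i + 1) - w ^ i) := by
    rw [Finset.sum_range_sub (fun i => w ^ i), pow_zero]
  have hinv : w * Complex.exp (Complex.I * (-θ : ℝ)) = 1 := by
    rw [hw, ← Complex.exp_add]; simp
  set v := Complex.exp (Complex.I * (-θ : ℝ)) with hv
  have hreidx : ∑ j ∈ Icc 1 m, (w ^ j - (w ^ m - 1) / (Complex.I * α)) =
      ∑ i ∈ range m, w ^ (i + 1) * ((v - 1 - Complex.I * (-θ : ℝ)) / (Complex.I * θ)) := by
    have hterm : ∀ i ∈ range m, w ^ (i + 1) * ((v - 1 - Complex.I * (-θ : ℝ)) / (Complex.I * θ)) =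
        w ^ (i + 1) - (w ^ (i + 1) - w ^ i) / (Complex.I * θ) := by
      intro i _
      push_cast
      field_simp
      linear_combination w ^ i * hinv
    rw [Finset.sum_congr rfl hterm, Finset.sum_sub_distrib, Finset.sum_sub_distrib,
      ← Finset.sum_div (range m), ← htel, Finset.sum_const, Nat.card_Icc, Nat.add_sub_cancel,
      nsmul_eq_mul, Finset.range_eq_Ico, Finset.sum_Ico_add' (fun j => w ^ j) 0 m 1, hαθ]
    congr 1
    push_cast
    field_simp
  rw [hwm, hreidx]
  have hterm : ∀ i ∈ range m,
      ‖w ^ (i + 1) * ((v - 1 - Complex.I * (-θ : ℝ)) / (Complex.I * θ))‖ ≤ 2 * |θ| := by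
    intro i _
    have h := norm_exp_I_mul_sub_one_sub_le (-θ)
    rw [norm_mul, norm_pow, hw1, one_pow, one_mul, norm_div, norm_mul, Complex.norm_I, one_mul,
      Complex.norm_real, Real.norm_eq_abs, div_le_iff₀ (abs_pos.2 hθ0)]
    rw [neg_sq, ← sq_abs] at h
    linarith
  calc _ ≤ ∑ i ∈ range m, 2 * |θ| := norm_sum_le_of_le _ hterm
    _ = 2 * |α| := by
      rw [Finset.sum_const, card_range, nsmul_eq_mul, hαθ, abs_mul, Nat.abs_cast]
      ring

/-- For every real `x ∉ ℤ` there is `C > 0` (depending only on `x`) such that for every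
positive integer `q > 2π|x|`,
`|c_q(x) − ((e^{2πix} − 1)/(2πix))·φ(q)| ≤ C·σ₀(q)`. -/
theorem stmt0 (x : ℝ) (hx : ∀ n : ℤ, x ≠ n) :
    ∃ C : ℝ, 0 < C ∧ ∀ q : ℕ, 0 < q → 2 * Real.pi * |x| < q →
      ‖cq q x - (Complex.exp (2 * (Real.pi : ℂ) * Complex.I * x) - 1) /
          (2 * (Real.pi : ℂ) * Complex.I * x) * (Nat.totient q : ℂ)‖
        ≤ C * (q.divisors.card : ℝ) := by
  have hx0 : x ≠ 0 := by simpa using hx 0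
  have hα : 2 * Real.pi * x ≠ 0 := by positivity
  refine ⟨2 * |2 * Real.pi * x|, by positivity, fun q hq _ => ?_⟩
  set A := (Complex.exp (2 * (Real.pi : ℂ) * Complex.I * x) - 1) /
    (2 * (Real.pi : ℂ) * Complex.I * x) with hA
  have hA' : A = (Complex.exp (Complex.I * (2 * Real.pi * x : ℝ)) - 1) /
      (Complex.I * (2 * Real.pi * x : ℝ)) := by
    rw [hA]
    push_cast
    ring_nf
  have hcard : ((Icc 1 q).filter (fun k => Nat.gcd k q = 1)).card = Nat.totient q := by
    rw [← Nat.filter_coprime_Ico_eq_totient q 1, add_comm 1 q]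
    congr 1
    ext k
    simp only [mem_filter, mem_Icc, mem_Ico, Nat.lt_succ_iff, Nat.coprime_comm (n := q),
      Nat.coprime_iff_gcd_eq_one]
  have hsum : cq q x - A * (Nat.totient q : ℂ) =
      ∑ d ∈ q.divisors, (ArithmeticFunction.moebius d : ℂ) * ∑ j ∈ Icc 1 (q / d),
        (Complex.exp (2 * (Real.pi : ℂ) * Complex.I * ((d * j : ℕ) : ℂ) * (x : ℂ) / (q : ℂ)) - A) := by
    rw [← sum_coprime_eq_sum_moebius hq (fun k =>
      Complex.exp (2 * (Real.pi : ℂ) * Complex.I * (k : ℂ) * (x : ℂ) / (q : ℂ)) - A),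
      Finset.sum_sub_distrib, Finset.sum_const, hcard, nsmul_eq_mul, mul_comm A, cq]
  have hterm : ∀ d ∈ q.divisors, ‖(ArithmeticFunction.moebius d : ℂ) * ∑ j ∈ Icc 1 (q / d),
      (Complex.exp (2 * (Real.pi : ℂ) * Complex.I * ((d * j : ℕ) : ℂ) * (x : ℂ) / (q : ℂ)) - A)‖ ≤
        2 * |2 * Real.pi * x| := by
    intro d hd
    have hd0 : 0 < d := Nat.pos_of_mem_divisors hd
    obtain ⟨m, rfl⟩ := Nat.dvd_of_mem_divisors hd
    have hm : 0 < m := Nat.pos_of_mul_pos_left hq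
    have hdC : (d : ℂ) ≠ 0 := by exact_mod_cast hd0.ne'
    have hmC : (m : ℂ) ≠ 0 := by exact_mod_cast hm.ne'
    have hexp : ∀ j ∈ Icc 1 m, Complex.exp (2 * (Real.pi : ℂ) * Complex.I * ((d * j : ℕ) : ℂ) *
        (x : ℂ) / ((d * m : ℕ) : ℂ)) - A =
          Complex.exp (Complex.I * (2 * Real.pi * x / m : ℝ)) ^ j - A := by
      intro j _
      rw [← Complex.exp_nat_mul]
      congr 2
      push_cast
      field_simp
    have hmu : ‖(ArithmeticFunction.moebius d : ℂ)‖ ≤ 1 := by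
      rw [Complex.norm_intCast]
      exact_mod_cast ArithmeticFunction.abs_moebius_le_one (n := d)
    rw [Nat.mul_div_cancel_left m hd0, Finset.sum_congr rfl hexp, hA', norm_mul]
    exact (mul_le_of_le_one_left (norm_nonneg _) hmu).trans (norm_sum_exp_sub_mean_le hα hm)
  rw [hsum]
  calc _ ≤ ∑ d ∈ q.divisors, 2 * |2 * Real.pi * x| := norm_sum_le_of_le _ hterm
    _ = _ := by rw [Finset.sum_const, nsmul_eq_mul, mul_comm]
end

section
/- For every real number x that is not an integer, the partial sums ∑_{q=1}^{Q} c_q(x)/q² tend to infinity in absolute value as Q → ∞; in particular, the series x·ζ(2)·∑_{q≥1} c_q(x)/q², defining the generalized sum-of-divisors function σ̃_1(x), diverges for every x ∈ ℝ \ ℤ. -/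
open Finset

/-- Grouping the fractions `k / q` by their reduced denominator expresses the geometric sum
`∑_{k ≤ q} e^{2πikx/q}` through the Ramanujan sums `c_d(x)` with `d ∣ q`. -/
theorem sum_divisors_cq (x : ℝ) {q : ℕ} (hq : 0 < q) :
    ∑ d ∈ q.divisors, cq d x =
      ∑ k ∈ Icc 1 q, Complex.exp (2 * (Real.pi : ℂ) * Complex.I * (k : ℂ) * (x : ℂ) / (q : ℂ)) := by
  rw [← sum_fiberwise_of_maps_to (s := Icc 1 q) (t := q.divisors) (g := fun k => q / Nat.gcd k q)]
  · refine sum_congr rfl fun d hd => ?_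
    obtain ⟨m, rfl⟩ := (Nat.mem_divisors.1 hd).1
    have hd0 : 0 < d := Nat.pos_of_mul_pos_right hq
    have hm0 : 0 < m := Nat.pos_of_mul_pos_left hq
    rw [cq]
    refine sum_bij' (fun k _ => k * m) (fun k _ => k / m) ?_ ?_ ?_ ?_ ?_
    · intro k hk
      simp only [mem_filter, mem_Icc] at hk ⊢
      refine ⟨⟨Nat.mul_pos hk.1.1 hm0, Nat.mul_le_mul_right m hk.1.2⟩, ?_⟩
      rw [Nat.gcd_mul_right, hk.2, one_mul, Nat.mul_div_cancel _ hm0]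
    · intro k hk
      simp only [mem_filter, mem_Icc] at hk ⊢
      have hg : Nat.gcd k (d * m) = m := by
        have h1 := Nat.div_mul_cancel (Nat.gcd_dvd_right k (d * m))
        rw [hk.2] at h1
        exact Nat.eq_of_mul_eq_mul_left hd0 h1
      have hmk : m ∣ k := by
        rw [← hg]
        exact Nat.gcd_dvd_left _ _
      obtain ⟨j, rfl⟩ := hmk
      rw [Nat.mul_div_cancel_left _ hm0]
      rw [mul_comm d m, Nat.gcd_mul_left] at hg
      refine ⟨⟨?_, ?_⟩, ?_⟩
      · exact Nat.pos_of_mul_pos_left (by omega : 0 < m * j)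
      · refine Nat.le_of_mul_le_mul_left (?_ : m * j ≤ m * d) hm0
        rw [mul_comm m d]
        exact hk.1.2
      · exact Nat.eq_of_mul_eq_mul_left hm0 (by rw [hg, mul_one])
    · intro k hk
      exact Nat.mul_div_cancel _ hm0
    · intro k hk
      simp only [mem_filter, mem_Icc] at hk
      have hg : Nat.gcd k (d * m) = m := by
        have h1 := Nat.div_mul_cancel (Nat.gcd_dvd_right k (d * m))
        rw [hk.2] at h1
        exact Nat.eq_of_mul_eq_mul_left hd0 h1
      refine Nat.div_mul_cancel ?_
      conv_lhs => rw [← hg]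
      exact Nat.gcd_dvd_left _ _
    · intro k hk
      have h1 : (d : ℂ) ≠ 0 := by exact_mod_cast hd0.ne'
      have h2 : (m : ℂ) ≠ 0 := by exact_mod_cast hm0.ne'
      congr 1
      push_cast
      field_simp
  · intro k hk
    exact Nat.mem_divisors.2 ⟨Nat.div_dvd_of_dvd (Nat.gcd_dvd_right k q), hq.ne'⟩

/-- The error of the trapezoidal rule for `exp` on a segment `[0, z]` of the imaginary axis. -/
theorem norm_trapezoid_exp_le {z : ℂ} (hz : z ≠ 0) (hre : z.re = 0) :
    ‖(Complex.exp z + 1) / 2 - (Complex.exp z - 1) / z‖ ≤ 3 * ‖z‖ ^ 2 := by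
  have hz0 : 0 < ‖z‖ := norm_pos_iff.2 hz
  rcases le_total ‖z‖ 1 with h | h
  · have hb := Complex.exp_bound h (n := 3) (by norm_num)
    set r := Complex.exp z - ∑ m ∈ range 3, z ^ m / (m.factorial : ℂ) with hr
    have he : Complex.exp z = 1 + z + z ^ 2 / 2 + r := by
      rw [hr]
      simp [sum_range_succ, Nat.factorial]
    have hb' : ‖r‖ ≤ ‖z‖ ^ 3 := by
      refine hb.trans ?_
      refine mul_le_of_le_one_right (by positivity) ?_
      norm_num [Nat.factorial]
    have h1 : (Complex.exp z + 1) / 2 - (Complex.exp z - 1) / z = z ^ 2 / 4 + r / 2 - r / z := by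
      rw [he]
      field_simp
      ring
    have h2 : ‖r / z‖ ≤ ‖z‖ ^ 2 := by
      rw [norm_div, div_le_iff₀ hz0]
      exact hb'.trans (le_of_eq (by ring))
    have h3 : ‖r / 2‖ ≤ ‖z‖ ^ 2 := by
      rw [norm_div]
      have : ‖z‖ ^ 3 ≤ ‖z‖ ^ 2 := pow_le_pow_of_le_one hz0.le h (by norm_num)
      have : 0 ≤ ‖z‖ ^ 2 := by positivity
      norm_num
      linarith
    have h4 : ‖z ^ 2 / 4‖ ≤ ‖z‖ ^ 2 := by
      rw [norm_div, norm_pow]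
      have : 0 ≤ ‖z‖ ^ 2 := by positivity
      norm_num
      linarith
    rw [h1]
    refine (norm_sub_le _ _).trans ?_
    have := norm_add_le (z ^ 2 / 4) (r / 2)
    linarith
  · have h1 : ‖Complex.exp z‖ = 1 := by rw [Complex.norm_exp, hre, Real.exp_zero]
    have h2 : ‖(Complex.exp z + 1) / 2‖ ≤ 1 := by
      have := norm_add_le (Complex.exp z) 1
      rw [h1, norm_one] at this
      rw [norm_div]
      norm_num
      linarith
    have h3 : ‖(Complex.exp z - 1) / z‖ ≤ 2 := by
      have := norm_sub_le (Complex.exp z) 1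
      rw [h1, norm_one] at this
      rw [norm_div, div_le_iff₀ hz0]
      linarith
    have := norm_sub_le ((Complex.exp z + 1) / 2) ((Complex.exp z - 1) / z)
    nlinarith

/-- The trapezoidal rule for `exp` with `n` steps of imaginary length `z`, written as a comparison of
a geometric sum with its continuous analogue. -/
theorem norm_sum_exp_sub_le {z : ℂ} (hz : z ≠ 0) (hre : z.re = 0) (n : ℕ) :
    ‖∑ k ∈ Icc 1 n, Complex.exp (k * z) - (Complex.exp (n * z) - 1) / z
      - (Complex.exp (n * z) - 1) / 2‖ ≤ n * (3 * ‖z‖ ^ 2) := by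
  induction n with
  | zero => simp
  | succ n ih =>
    have h1 : ‖Complex.exp (n * z)‖ = 1 := by
      rw [Complex.norm_exp]
      simp [hre]
    have h2 : ‖Complex.exp (n * z) *
        ((Complex.exp z + 1) / 2 - (Complex.exp z - 1) / z)‖ ≤ 3 * ‖z‖ ^ 2 := by
      rw [norm_mul, h1, one_mul]
      exact norm_trapezoid_exp_le hz hre
    have h3 : Complex.exp ((n + 1 : ℕ) * z) = Complex.exp (n * z) * Complex.exp z := by
      rw [← Complex.exp_add]
      push_cast
      ring_nf
    rw [sum_Icc_succ_top (by omega), h3]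
    have h4 := norm_add_le (∑ k ∈ Icc 1 n, Complex.exp (k * z) - (Complex.exp (n * z) - 1) / z
      - (Complex.exp (n * z) - 1) / 2) (Complex.exp (n * z) *
        ((Complex.exp z + 1) / 2 - (Complex.exp z - 1) / z))
    push_cast
    calc _ = _ := by
          congr 1
          ring
      _ ≤ _ := h4
      _ ≤ _ := by linarith

/-- If the divisor sums of `E` are `O(1 / n)`, then `E(n)` is `O(√n)`. -/
theorem norm_le_of_norm_sum_divisors_le {E : ℕ → ℂ} {C : ℝ}
    (hE : ∀ n : ℕ, 0 < n → ‖∑ d ∈ n.divisors, E d‖ ≤ C / n) {n : ℕ} (hn : 0 < n) :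
    ‖E n‖ ≤ 3 * C * (n : ℝ) ^ (1 / 2 : ℝ) := by
  have hC : 0 ≤ C := by
    have := (norm_nonneg _).trans (hE 1 one_pos)
    simpa using this
  have hmob := (ArithmeticFunction.sum_eq_iff_sum_mul_moebius_eq (f := E)
    (g := fun n => ∑ d ∈ n.divisors, E d)).1 (fun _ _ => rfl) n hn
  rw [← hmob]
  have h1 : ∀ p ∈ n.divisorsAntidiagonal,
      ‖((ArithmeticFunction.moebius p.1 : ℤ) : ℂ) * ∑ d ∈ p.2.divisors, E d‖ ≤ C / p.2 := by
    intro p hp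
    have hp2 : 0 < p.2 := Nat.pos_of_ne_zero (Nat.ne_zero_of_mem_divisorsAntidiagonal hp).2
    rw [norm_mul]
    refine (mul_le_of_le_one_left (norm_nonneg _) ?_).trans (hE _ hp2)
    rw [Complex.norm_intCast]
    exact_mod_cast ArithmeticFunction.abs_moebius_le_one
  have h2 : ∑ d ∈ n.divisors, C / (d : ℝ) ≤ ∑ d ∈ Icc 1 n, C / (d : ℝ) := by
    refine sum_le_sum_of_subset_of_nonneg ?_ fun _ _ _ => by positivity
    intro d hd
    exact mem_Icc.2 ⟨Nat.pos_of_mem_divisors hd, Nat.divisor_le hd⟩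
  have h3 : ∑ d ∈ Icc 1 n, C / (d : ℝ) = C * (harmonic n : ℝ) := by
    rw [harmonic_eq_sum_Icc]
    push_cast
    rw [mul_sum]
    rfl
  have h4 := harmonic_le_one_add_log n
  have h5 : Real.log n ≤ (n : ℝ) ^ (1 / 2 : ℝ) / (1 / 2) :=
    Real.log_le_rpow_div (by positivity) (by norm_num)
  have h6 : (1 : ℝ) ≤ (n : ℝ) ^ (1 / 2 : ℝ) :=
    Real.one_le_rpow (by exact_mod_cast hn) (by norm_num)
  refine (norm_sum_le_of_le _ h1).trans ?_
  rw [Nat.sum_divisorsAntidiagonal' (f := fun _ j : ℕ => C / (j : ℝ))]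
  rw [h3] at h2
  refine h2.trans ?_
  calc C * (harmonic n : ℝ) ≤ C * (3 * (n : ℝ) ^ (1 / 2 : ℝ)) :=
        mul_le_mul_of_nonneg_left (by linarith) hC
    _ = _ := by ring

/-- The series `∑ φ(q) / q²` diverges. -/
theorem tendsto_sum_totient_div_sq :
    Filter.Tendsto (fun Q : ℕ => ∑ q ∈ Icc 1 Q, (Nat.totient q : ℝ) / (q : ℝ) ^ 2)
      Filter.atTop Filter.atTop := by
  have hns : ¬ Summable (fun q : ℕ => (Nat.totient q : ℝ) / (q : ℝ) ^ 2) := by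
    intro hs
    refine not_summable_one_div_on_primes ?_
    refine Summable.of_nonneg_of_le (fun n => ?_) (fun n => ?_) (hs.mul_left 2)
    · exact Set.indicator_nonneg (fun _ _ => by positivity) _
    · by_cases hp : n.Prime
      · rw [Set.indicator_of_mem (by exact hp), Nat.totient_prime hp,
          Nat.cast_sub hp.one_le]
        have h2 : (2 : ℝ) ≤ n := by exact_mod_cast hp.two_le
        rw [← mul_div_assoc, div_le_div_iff₀ (by linarith) (by positivity)]
        push_cast
        nlinarith
      · rw [Set.indicator_of_notMem (by exact hp)]
        positivity
  have h := (not_summable_iff_tendsto_nat_atTop_of_nonneg (fun q => by positivity)).1 hns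
  refine (h.comp (Filter.tendsto_add_atTop_nat 1)).congr fun Q => ?_
  rw [Function.comp_apply, Nat.range_succ_eq_Icc_zero, ← add_sum_Ioc_eq_sum_Icc (Nat.zero_le Q),
    Nat.totient_zero, Nat.cast_zero, zero_div, zero_add]
  rfl

theorem zetaR_two_ne_zero : zetaR 2 ≠ 0 := by
  have hs : Summable (fun n : ℕ => 1 / (n + 1 : ℝ) ^ (2 : ℝ)) := by
    have := (summable_nat_add_iff 1).2 (Real.summable_one_div_nat_rpow.2 (by norm_num : (1 : ℝ) < 2))
    simpa using this
  exact (hs.tsum_pos (fun n => by positivity) 0 (by simp)).ne'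

theorem exp_two_pi_I_mul_ne_one {x : ℝ} (hx : ∀ n : ℤ, x ≠ n) :
    Complex.exp (2 * (Real.pi : ℂ) * Complex.I * (x : ℂ)) ≠ 1 := by
  intro h
  obtain ⟨n, hn⟩ := Complex.exp_eq_one_iff.1 h
  refine hx n ?_
  have h1 : (x : ℂ) = n := by
    refine mul_left_cancel₀ Complex.two_pi_I_ne_zero ?_
    rw [hn]
    ring
  exact_mod_cast h1

/-- For nonzero `x`, up to an additive correction at `q = 1`, the Ramanujan sum `c_q(x)` equals `φ(q)`
times the mean of `e^{2πixt}` over `[0, 1]`, with an error `O(√q)`. -/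
theorem exists_norm_cq_sub_le {x : ℝ} (hx : x ≠ 0) :
    ∃ C : ℝ, ∀ q : ℕ, 0 < q →
      ‖cq q x - (Complex.exp (2 * (Real.pi : ℂ) * Complex.I * (x : ℂ)) - 1) /
          (2 * (Real.pi : ℂ) * Complex.I * (x : ℂ)) * (Nat.totient q : ℂ)
        - if q = 1 then (Complex.exp (2 * (Real.pi : ℂ) * Complex.I * (x : ℂ)) - 1) / 2 else 0‖
      ≤ C * (q : ℝ) ^ (1 / 2 : ℝ) := by
  set w : ℂ := 2 * (Real.pi : ℂ) * Complex.I * (x : ℂ) with hw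
  have hw0 : w ≠ 0 := mul_ne_zero Complex.two_pi_I_ne_zero (by exact_mod_cast hx)
  have hwre : w.re = 0 := by simp [hw]
  refine ⟨3 * (3 * ‖w‖ ^ 2), fun q hq => norm_le_of_norm_sum_divisors_le (E := fun q =>
    cq q x - (Complex.exp w - 1) / w * (Nat.totient q : ℂ)
      - if q = 1 then (Complex.exp w - 1) / 2 else 0) (fun n hn => ?_) hq⟩
  have hn0 : (n : ℂ) ≠ 0 := by exact_mod_cast hn.ne'
  have h := norm_sum_exp_sub_le (z := w / n) (div_ne_zero hw0 hn0)
    (by rw [Complex.div_natCast_re, hwre, zero_div]) n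
  rw [mul_div_cancel₀ _ hn0] at h
  have h1 : ∑ d ∈ n.divisors, (d.totient : ℂ) = n := by exact_mod_cast Nat.sum_totient n
  rw [sum_sub_distrib, sum_sub_distrib, sum_divisors_cq x hn, ← mul_sum, h1, sum_ite_eq',
    if_pos (Nat.one_mem_divisors.2 hn.ne')]
  have h2 : (n : ℝ) * (3 * ‖w / n‖ ^ 2) = 3 * ‖w‖ ^ 2 / n := by
    have : (n : ℝ) ≠ 0 := by exact_mod_cast hn.ne'
    rw [norm_div, Complex.norm_natCast]
    field_simp
  rw [h2] at h
  convert h using 4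
  · refine sum_congr rfl fun k _ => ?_
    rw [hw]
    congr 1
    ring
  · field_simp

/-- The partial sums of `∑ c_q(x) / q²` tend to infinity in absolute value for non-integral `x`. -/
theorem tendsto_norm_sum_cq_div_sq {x : ℝ} (hx : ∀ n : ℤ, x ≠ n) :
    Filter.Tendsto (fun Q : ℕ => ‖∑ q ∈ Icc 1 Q, cq q x / (q : ℂ) ^ 2‖)
      Filter.atTop Filter.atTop := by
  have hx0 : x ≠ 0 := by simpa using hx 0
  obtain ⟨C, hC⟩ := exists_norm_cq_sub_le hx0
  set w : ℂ := 2 * (Real.pi : ℂ) * Complex.I * (x : ℂ) with hw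
  have hw0 : w ≠ 0 := mul_ne_zero Complex.two_pi_I_ne_zero (by exact_mod_cast hx0)
  set A : ℂ := (Complex.exp w - 1) / w with hA
  set B : ℂ := (Complex.exp w - 1) / 2
  have hA0 : A ≠ 0 := div_ne_zero (sub_ne_zero.2 (exp_two_pi_I_mul_ne_one hx)) hw0
  have hsum : Summable (fun q : ℕ => 1 / (q : ℝ) ^ (3 / 2 : ℝ)) :=
    Real.summable_one_div_nat_rpow.2 (by norm_num)
  have hC0 : 0 ≤ C := by simpa using (norm_nonneg _).trans (hC 1 one_pos)
  set M : ℝ := C * ∑' q : ℕ, 1 / (q : ℝ) ^ (3 / 2 : ℝ) with hM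
  have herr : ∀ Q : ℕ, ‖∑ q ∈ Icc 1 Q,
      (cq q x - A * (Nat.totient q : ℂ) - if q = 1 then B else 0) / (q : ℂ) ^ 2‖ ≤ M := by
    intro Q
    have h1 : ∀ q ∈ Icc 1 Q,
        ‖(cq q x - A * (Nat.totient q : ℂ) - if q = 1 then B else 0) / (q : ℂ) ^ 2‖
          ≤ C * (1 / (q : ℝ) ^ (3 / 2 : ℝ)) := by
      intro q hq
      have hq0 : 0 < q := (mem_Icc.1 hq).1
      have hqR : (0 : ℝ) < q := by exact_mod_cast hq0
      rw [norm_div, norm_pow, Complex.norm_natCast, div_le_iff₀ (by positivity)]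
      refine (hC q hq0).trans (le_of_eq ?_)
      rw [mul_assoc]
      congr 1
      rw [one_div ((q : ℝ) ^ (3 / 2 : ℝ)), ← Real.rpow_neg hqR.le, ← Real.rpow_natCast,
        ← Real.rpow_add hqR]
      norm_num
    refine (norm_sum_le_of_le _ h1).trans ?_
    rw [← mul_sum]
    exact mul_le_mul_of_nonneg_left (hsum.sum_le_tsum _ fun _ _ => by positivity) hC0
  have hlow : ∀ Q : ℕ, ‖A‖ * ∑ q ∈ Icc 1 Q, (Nat.totient q : ℝ) / (q : ℝ) ^ 2 - (‖B‖ + M)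
      ≤ ‖∑ q ∈ Icc 1 Q, cq q x / (q : ℂ) ^ 2‖ := by
    intro Q
    have h1 : ∑ q ∈ Icc 1 Q, cq q x / (q : ℂ) ^ 2 -
        (∑ q ∈ Icc 1 Q,
          (cq q x - A * (Nat.totient q : ℂ) - if q = 1 then B else 0) / (q : ℂ) ^ 2)
        - ∑ q ∈ Icc 1 Q, (if q = 1 then B else 0)
        = A * ((∑ q ∈ Icc 1 Q, (Nat.totient q : ℝ) / (q : ℝ) ^ 2 : ℝ) : ℂ) := by
      push_cast
      rw [mul_sum, ← sum_sub_distrib, ← sum_sub_distrib]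
      refine sum_congr rfl fun q _ => ?_
      split_ifs with h
      · subst h
        simp only [Nat.totient_one, Nat.cast_one]
        ring
      · ring
    have h2 : ‖∑ q ∈ Icc 1 Q, (if q = 1 then B else 0)‖ ≤ ‖B‖ := by
      rw [sum_ite_eq']
      split_ifs <;> simp
    have h3 := congrArg norm h1
    rw [norm_mul, Complex.norm_real, Real.norm_of_nonneg
      (sum_nonneg fun _ _ => by positivity)] at h3
    rw [← h3]
    have h4 := norm_sub_le (∑ q ∈ Icc 1 Q, cq q x / (q : ℂ) ^ 2 -
        (∑ q ∈ Icc 1 Q,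
          (cq q x - A * (Nat.totient q : ℂ) - if q = 1 then B else 0) / (q : ℂ) ^ 2))
        (∑ q ∈ Icc 1 Q, (if q = 1 then B else 0))
    have h5 := norm_sub_le (∑ q ∈ Icc 1 Q, cq q x / (q : ℂ) ^ 2)
        (∑ q ∈ Icc 1 Q,
          (cq q x - A * (Nat.totient q : ℂ) - if q = 1 then B else 0) / (q : ℂ) ^ 2)
    linarith [herr Q]
  exact Filter.tendsto_atTop_mono hlow (Filter.tendsto_atTop_add_const_right _ _
    (tendsto_sum_totient_div_sq.const_mul_atTop (norm_pos_iff.2 hA0)))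

/-- For every real `x ∉ ℤ`, the partial sums `∑_{q=1}^{Q} c_q(x)/q²` tend to infinity in
absolute value as `Q → ∞`; in particular the series `x·ζ(2)·∑_{q≥1} c_q(x)/q²`
(defining the generalized sum-of-divisors function `σ̃₁(x)`) diverges. -/
theorem stmt2 (x : ℝ) (hx : ∀ n : ℤ, x ≠ n) :
    Filter.Tendsto (fun Q : ℕ => ‖∑ q ∈ Finset.Icc 1 Q, cq q x / (q : ℂ) ^ 2‖)
      Filter.atTop Filter.atTop ∧
    ¬ ∃ L : ℂ, Filter.Tendsto
      (fun Q : ℕ => (x : ℂ) * (zetaR 2 : ℂ) * ∑ q ∈ Finset.Icc 1 Q, cq q x / (q : ℂ) ^ 2)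
      Filter.atTop (nhds L) := by
  have h := tendsto_norm_sum_cq_div_sq hx
  refine ⟨h, ?_⟩
  rintro ⟨L, hL⟩
  have hx0 : x ≠ 0 := by simpa using hx 0
  have hc : (x : ℂ) * (zetaR 2 : ℂ) ≠ 0 :=
    mul_ne_zero (by exact_mod_cast hx0) (by exact_mod_cast zetaR_two_ne_zero)
  refine not_tendsto_nhds_of_tendsto_atTop (h.const_mul_atTop (norm_pos_iff.2 hc)) ‖L‖ ?_
  exact hL.norm.congr fun Q => norm_mul _ _
end

section
/- For every real number x that is not an integer, the series ∑_{q≥1} c_q(x)/q does not converge (its sequence of partial sums has no limit). -/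
open Finset

/-- The telescoping geometric sum evaluates `c_p(x)` at a prime `p`. -/
theorem cq_prime_mul {p : ℕ} (hp : p.Prime) (x : ℝ) :
    cq p x * (Complex.exp (Complex.I * (2 * Real.pi * x / p : ℝ)) - 1) =
      Complex.exp (Complex.I * (2 * Real.pi * x : ℝ)) -
        Complex.exp (Complex.I * (2 * Real.pi * x / p : ℝ)) := by
  have hp0 : (p : ℂ) ≠ 0 := by exact_mod_cast hp.ne_zero
  have hfilter : (Finset.Icc 1 p).filter (fun k => Nat.gcd k p = 1) = Finset.Ico 1 p := by
    ext k
    simp only [Finset.mem_filter, Finset.mem_Icc, Finset.mem_Ico]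
    constructor
    · rintro ⟨⟨h1, h2⟩, h3⟩
      refine ⟨h1, lt_of_le_of_ne h2 ?_⟩
      rintro rfl
      exact hp.one_lt.ne' (by simpa using h3)
    · rintro ⟨h1, h2⟩
      exact ⟨⟨h1, h2.le⟩, (Nat.coprime_of_lt_prime (by omega) h2 hp).symm⟩
  have hsum : cq p x =
      ∑ k ∈ Finset.Ico 1 p, Complex.exp (Complex.I * (2 * Real.pi * x / p : ℝ)) ^ k := by
    rw [cq, hfilter]
    refine Finset.sum_congr rfl fun k _ => ?_
    rw [← Complex.exp_nat_mul]
    congr 1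
    push_cast
    ring
  rw [hsum, geom_sum_Ico_mul _ hp.one_lt.le, pow_one, ← Complex.exp_nat_mul]
  congr 2
  push_cast
  field_simp

/-- For every real `x ∉ ℤ`, the series `∑_{q≥1} c_q(x)/q` does not converge
(its sequence of partial sums has no limit). -/
theorem stmt5 (x : ℝ) (hx : ∀ n : ℤ, x ≠ n) :
    ¬ ∃ L : ℂ, Filter.Tendsto (fun Q : ℕ => ∑ q ∈ Finset.Icc 1 Q, cq q x / (q : ℂ))
      Filter.atTop (nhds L) := by
  rintro ⟨L, hL⟩
  have hterm : Filter.Tendsto (fun q : ℕ => cq q x / (q : ℂ)) Filter.atTop (nhds 0) := by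
    rw [← Filter.tendsto_add_atTop_iff_nat 1]
    have h := ((Filter.tendsto_add_atTop_iff_nat 1).2 hL).sub hL
    rw [sub_self] at h
    refine h.congr fun Q => ?_
    rw [Finset.sum_Icc_succ_top (by omega), add_sub_cancel_left]
  have hzero : Filter.Tendsto
      (fun q : ℕ => cq q x * (Complex.exp (Complex.I * (2 * Real.pi * x / q : ℝ)) - 1))
      Filter.atTop (nhds 0) := by
    have h := hterm.norm.mul_const ‖2 * Real.pi * x‖
    rw [norm_zero, zero_mul] at h
    refine squeeze_zero_norm' ?_ h
    filter_upwards [Filter.eventually_gt_atTop 0] with q hq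
    have hq' : (0 : ℝ) < q := by exact_mod_cast hq
    calc _ ≤ ‖cq q x‖ * ‖2 * Real.pi * x / q‖ := by
          rw [norm_mul]
          gcongr
          exact Real.norm_exp_I_mul_ofReal_sub_one_le
      _ = _ := by
          rw [norm_div, norm_div, Complex.norm_natCast, Real.norm_natCast]
          ring
  have hlim : Filter.Tendsto
      (fun q : ℕ => Complex.exp (Complex.I * (2 * Real.pi * x : ℝ)) -
        Complex.exp (Complex.I * (2 * Real.pi * x / q : ℝ)))
      Filter.atTop (nhds (Complex.exp (Complex.I * (2 * Real.pi * x : ℝ)) - 1)) := by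
    have h : Filter.Tendsto (fun q : ℕ => 2 * Real.pi * x / (q : ℝ)) Filter.atTop (nhds 0) :=
      tendsto_const_div_atTop_nhds_zero_nat _
    have hc : Continuous fun t : ℝ => Complex.exp (Complex.I * t) := by fun_prop
    have he := (hc.tendsto 0).comp h
    simp only [Complex.ofReal_zero, mul_zero, Complex.exp_zero] at he
    exact he.const_sub _
  have hprime : Filter.Tendsto (Nat.nth Nat.Prime) Filter.atTop Filter.atTop :=
    (Nat.nth_strictMono Nat.infinite_setOfPred_prime).tendsto_atTop
  have heq := tendsto_nhds_unique ((hzero.comp hprime).congr fun n =>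
    cq_prime_mul (Nat.prime_nth_prime n) x) (hlim.comp hprime)
  obtain ⟨n, hn⟩ := Complex.exp_eq_one_iff.1 (sub_eq_zero.1 heq.symm)
  refine hx n ?_
  have h2 : (2 * Real.pi * Complex.I : ℂ) ≠ 0 := Complex.two_pi_I_ne_zero
  have h3 : (x : ℂ) = n := by
    refine mul_right_cancel₀ h2 (Eq.trans ?_ hn)
    push_cast
    ring
  exact_mod_cast h3
end

section
/- For every real number x that is not an integer, the series ∑_{q≥1} c_q(x)/φ(q) does not converge (its sequence of partial sums has no limit). -/
open Finset

theorem one_add_cq_prime {p : ℕ} (hp : p.Prime) (x : ℝ) :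
    1 + cq p x =
      ∑ k ∈ Finset.range p, Complex.exp (2 * (Real.pi : ℂ) * Complex.I * (x : ℂ) / (p : ℂ)) ^ k := by
  have hset : (Finset.Icc 1 p).filter (fun k => Nat.gcd k p = 1) = (Finset.range p).erase 0 := by
    ext k
    simp only [Finset.mem_filter, Finset.mem_Icc, Finset.mem_erase, Finset.mem_range]
    constructor
    · rintro ⟨⟨h1, h2⟩, h3⟩
      refine ⟨by omega, lt_of_le_of_ne h2 ?_⟩
      rintro rfl
      exact hp.one_lt.ne' (by simpa using h3)
    · rintro ⟨h1, h2⟩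
      exact ⟨⟨by omega, h2.le⟩, ((hp.coprime_iff_not_dvd.2 (Nat.not_dvd_of_pos_of_lt (by omega) h2)).symm)⟩
  rw [cq, hset, ← Finset.add_sum_erase _ _ (Finset.mem_range.2 hp.pos), pow_zero]
  congr 1
  refine Finset.sum_congr rfl fun k _ => ?_
  rw [← Complex.exp_nat_mul]
  congr 1
  ring

theorem norm_exp_sub_one_le_cq {p : ℕ} (hp : p.Prime) (x : ℝ) :
    ‖Complex.exp (2 * (Real.pi : ℂ) * Complex.I * (x : ℂ)) - 1‖ ≤
      |2 * Real.pi * x| * (‖cq p x / (Nat.totient p : ℂ)‖ + 1 / ((p : ℝ) - 1)) := by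
  have hp0 : (0 : ℝ) < p := by exact_mod_cast hp.pos
  have hp1 : (0 : ℝ) < (p : ℝ) - 1 := sub_pos.2 (by exact_mod_cast hp.one_lt)
  set w := Complex.exp (2 * (Real.pi : ℂ) * Complex.I * (x : ℂ) / (p : ℂ)) with hw
  have hwp : w ^ p = Complex.exp (2 * (Real.pi : ℂ) * Complex.I * (x : ℂ)) := by
    rw [hw, ← Complex.exp_nat_mul, mul_div_cancel₀ _ (by exact_mod_cast hp.ne_zero)]
  have hw1 : ‖w - 1‖ ≤ |2 * Real.pi * x| / p := by
    have h := Real.norm_exp_I_mul_ofReal_sub_one_le (x := 2 * Real.pi * x / p)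
    rw [Real.norm_eq_abs, abs_div, abs_of_pos hp0] at h
    convert h using 4
    push_cast
    ring
  have hφ : ‖cq p x / (Nat.totient p : ℂ)‖ = ‖cq p x‖ / ((p : ℝ) - 1) := by
    rw [norm_div, Complex.norm_natCast, Nat.totient_prime hp, Nat.cast_sub hp.one_le, Nat.cast_one]
  rw [← hwp, ← geom_sum_mul, ← one_add_cq_prime hp, norm_mul, hφ, ← add_div, mul_comm]
  calc ‖w - 1‖ * ‖1 + cq p x‖
      ≤ |2 * Real.pi * x| / p * (‖cq p x‖ + 1) := by
        gcongr
        simpa [add_comm] using norm_add_le (1 : ℂ) (cq p x)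
    _ ≤ |2 * Real.pi * x| * ((‖cq p x‖ + 1) / ((p : ℝ) - 1)) := by
        rw [div_mul_eq_mul_div, mul_div_assoc]
        gcongr
        linarith

/-- For every real `x ∉ ℤ`, the series `∑_{q≥1} c_q(x)/φ(q)` does not converge
(its sequence of partial sums has no limit). -/
theorem stmt6 (x : ℝ) (hx : ∀ n : ℤ, x ≠ n) :
    ¬ ∃ L : ℂ, Filter.Tendsto
      (fun Q : ℕ => ∑ q ∈ Finset.Icc 1 Q, cq q x / (Nat.totient q : ℂ))
      Filter.atTop (nhds L) := by
  rintro ⟨L, hL⟩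
  have hterm : Filter.Tendsto (fun q : ℕ => cq q x / (Nat.totient q : ℂ)) Filter.atTop (nhds 0) := by
    rw [← Filter.tendsto_add_atTop_iff_nat 1]
    have h := ((Filter.tendsto_add_atTop_iff_nat 1).2 hL).sub hL
    simpa [Finset.sum_Icc_succ_top] using h
  have hinv : Filter.Tendsto (fun q : ℕ => 1 / ((q : ℝ) - 1)) Filter.atTop (nhds 0) := by
    simp only [one_div]
    exact (Filter.tendsto_atTop_add_const_right _ (-1)
      tendsto_natCast_atTop_atTop).inv_tendsto_atTop
  have hbound := (hterm.norm.add hinv).const_mul |2 * Real.pi * x|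
  rw [norm_zero, add_zero, mul_zero] at hbound
  have hle := ge_of_tendsto_of_frequently hbound
    ((Nat.frequently_atTop_iff_infinite.2 Nat.infinite_setOfPred_prime).mono
      fun p hp => norm_exp_sub_one_le_cq hp x)
  exact exp_two_pi_I_mul_ne_one hx (sub_eq_zero.1 (norm_le_zero_iff.1 hle))
end

section
/- Let f̂ : ℕ → ℝ be a nonnegative function for which there exist a constant C > 0 and a positive integer Q₀ such that f̂(q) ≥ C/q² for all q ≥ Q₀. Then for every real number x that is not an integer, the partial sums ∑_{q=1}^{Q} f̂(q) · c_q(x) are unbounded in absolute value as Q → ∞; in particular, the series ∑_{q≥1} f̂(q) c_q(x) diverges. -/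
open Finset

open Filter Topology

theorem sum_exp_mul_one_sub_exp_neg (b : ℂ) (n : ℕ) :
    (∑ k ∈ Icc 1 n, Complex.exp (k * b)) * (1 - Complex.exp (-b)) = Complex.exp (n * b) - 1 := by
  induction n with
  | zero => simp
  | succ n ih =>
    rw [sum_Icc_succ_top (by omega), add_mul, ih]
    have h : Complex.exp (((n + 1 : ℕ) : ℂ) * b) * Complex.exp (-b) = Complex.exp (n * b) := by
      rw [← Complex.exp_add]
      push_cast
      ring_nf
    rw [mul_sub, h]
    ring

/-- Riemann sums of `t ↦ exp (t * a)` on `[0, 1]` differ from `n` times the integral by a bounded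
amount. -/
theorem exists_norm_sum_exp_sub_le {a : ℂ} (ha : a ≠ 0) (hre : a.re = 0) :
    ∃ K : ℝ, 0 ≤ K ∧ ∀ n : ℕ, 0 < n →
      ‖∑ k ∈ Icc 1 n, (Complex.exp (k * a / n) - (Complex.exp a - 1) / a)‖ ≤ K := by
  set I : ℂ := (Complex.exp a - 1) / a with hI
  have ha' : 0 < ‖a‖ := norm_pos_iff.mpr ha
  refine ⟨‖a‖ * (1 + ‖I‖), by positivity, fun n hn => ?_⟩
  have hn' : (0 : ℝ) < n := by exact_mod_cast hn
  have hnC : (n : ℂ) ≠ 0 := by exact_mod_cast hn.ne'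
  have hterm : ∀ k : ℕ, ‖Complex.exp (k * a / n)‖ = 1 := fun k => by
    rw [Complex.norm_exp, show (k : ℂ) * a / n = ((k / n : ℝ) : ℂ) * a by push_cast; ring,
      Complex.re_ofReal_mul, hre, mul_zero, Real.exp_zero]
  rcases le_total ‖a‖ n with h | h
  · set S := ∑ k ∈ Icc 1 n, Complex.exp (k * a / n) with hS
    have hSn : ‖S‖ ≤ n := by
      refine (norm_sum_le _ _).trans ?_
      simp [hterm]
    have htel := sum_exp_mul_one_sub_exp_neg (a / n) n
    rw [mul_div_cancel₀ _ hnC] at htel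
    simp only [← mul_div_assoc] at htel
    rw [← hS] at htel
    have hb : ‖-(a / n)‖ = ‖a‖ / n := by simp
    have hquad := Complex.norm_exp_sub_one_sub_id_le (x := -(a / n))
      (by rw [hb]; exact (div_le_one hn').mpr h)
    rw [hb] at hquad
    have hid : ∑ k ∈ Icc 1 n, (Complex.exp (k * a / n) - I)
        = S * (Complex.exp (-(a / n)) - 1 - -(a / n)) * (n / a) := by
      rw [sum_sub_distrib, ← hS, sum_const, Nat.card_Icc, nsmul_eq_mul, hI, ← htel]
      push_cast [Nat.add_sub_cancel]
      field_simp
      ring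
    rw [hid, norm_mul, norm_mul, norm_div, Complex.norm_natCast]
    calc ‖S‖ * ‖Complex.exp (-(a / n)) - 1 - -(a / n)‖ * (n / ‖a‖)
        ≤ n * (‖a‖ / n) ^ 2 * (n / ‖a‖) := by gcongr
      _ = ‖a‖ := by field_simp
      _ ≤ ‖a‖ * (1 + ‖I‖) := by nlinarith [norm_nonneg I]
  · calc ‖∑ k ∈ Icc 1 n, (Complex.exp (k * a / n) - I)‖
        ≤ ∑ k ∈ Icc 1 n, (1 + ‖I‖) := norm_sum_le_of_le _ fun k _ => by
          have := norm_sub_le (Complex.exp (k * a / n)) I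
          rwa [hterm] at this
      _ = n * (1 + ‖I‖) := by rw [sum_const, Nat.card_Icc, nsmul_eq_mul, Nat.add_sub_cancel]
      _ ≤ ‖a‖ * (1 + ‖I‖) := by gcongr

/-- Sifting by a set of primes multiplies a uniform bound for the sums of `F (k / n)` over
`1 ≤ k ≤ n` by at most a power of two. -/
theorem norm_sum_sifted_le {F : ℚ → ℂ} {K : ℝ}
    (hF : ∀ n : ℕ, 0 < n → ‖∑ k ∈ Icc 1 n, F (k / n)‖ ≤ K) (P : Finset ℕ)
    (hP : ∀ p ∈ P, p.Prime) (n : ℕ) (hn : 0 < n) (hdvd : ∀ p ∈ P, p ∣ n) :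
    ‖∑ k ∈ Icc 1 n with ∀ p ∈ P, ¬ p ∣ k, F (k / n)‖ ≤ 2 ^ #P * K := by
  induction P using Finset.induction_on generalizing n with
  | empty => simpa using hF n hn
  | insert p P hpP ih =>
    have hp : p.Prime := hP p (mem_insert_self _ _)
    obtain ⟨m, rfl⟩ := hdvd p (mem_insert_self _ _)
    have hP' : ∀ r ∈ P, r.Prime := fun r hr => hP r (mem_insert_of_mem hr)
    have hm : 0 < m := Nat.pos_of_mul_pos_left hn
    have hcop : ∀ r ∈ P, ∀ k, r ∣ p * k ↔ r ∣ k := fun r hr k =>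
      ((Nat.coprime_primes (hP' r hr) hp).mpr (ne_of_mem_of_not_mem hr hpP)).dvd_mul_left
    have hdvd' : ∀ r ∈ P, r ∣ m := fun r hr =>
      (hcop r hr m).mp (hdvd r (mem_insert_of_mem hr))
    have h1 := ih hP' (p * m) hn fun r hr => hdvd r (mem_insert_of_mem hr)
    have h2 := ih hP' m hm hdvd'
    have hmult : ∑ k ∈ Icc 1 (p * m) with (∀ r ∈ P, ¬ r ∣ k) ∧ p ∣ k, F (k / (p * m : ℕ))
        = ∑ k ∈ Icc 1 m with ∀ r ∈ P, ¬ r ∣ k, F (k / m) := by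
      symm
      refine sum_bij (fun k _ => p * k) ?_ ?_ ?_ ?_
      · intro k hk
        simp only [mem_filter, mem_Icc] at hk ⊢
        refine ⟨⟨Nat.mul_pos hp.pos hk.1.1, Nat.mul_le_mul_left _ hk.1.2⟩, fun r hr => ?_,
          dvd_mul_right _ _⟩
        rw [hcop r hr]
        exact hk.2 r hr
      · intro k _ l _ h
        exact Nat.eq_of_mul_eq_mul_left hp.pos h
      · intro k hk
        simp only [mem_filter, mem_Icc] at hk
        obtain ⟨⟨hk1, hk2⟩, hk3, l, rfl⟩ := hk
        refine ⟨l, ?_, rfl⟩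
        simp only [mem_filter, mem_Icc]
        refine ⟨⟨Nat.pos_of_mul_pos_left hk1, Nat.le_of_mul_le_mul_left hk2 hp.pos⟩,
          fun r hr => ?_⟩
        rw [← hcop r hr]
        exact hk3 r hr
      · intro k _
        have : (p : ℚ) ≠ 0 := by exact_mod_cast hp.ne_zero
        push_cast
        rw [mul_div_mul_left _ _ this]
    have hsplit := sum_filter_add_sum_filter_not
      ((Icc 1 (p * m)).filter fun k => ∀ r ∈ P, ¬ r ∣ k) (fun k => p ∣ k)
      (fun k => F (k / (p * m : ℕ)))
    rw [filter_filter, filter_filter, hmult] at hsplit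
    have hset : ((Icc 1 (p * m)).filter fun k => ∀ r ∈ insert p P, ¬ r ∣ k)
        = (Icc 1 (p * m)).filter fun k => (∀ r ∈ P, ¬ r ∣ k) ∧ ¬ p ∣ k := by
      refine filter_congr fun k _ => ?_
      rw [forall_mem_insert, and_comm]
    rw [hset, eq_sub_of_add_eq' hsplit, card_insert_of_notMem hpP, pow_succ]
    refine (norm_sub_le _ _).trans ?_
    linarith

theorem norm_cq_sub_le {x K : ℝ} {I : ℂ}
    (hK : ∀ n : ℕ, 0 < n →
      ‖∑ k ∈ Icc 1 n, (Complex.exp (k * (2 * Real.pi * Complex.I * x) / n) - I)‖ ≤ K)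
    {q : ℕ} (hq : 0 < q) :
    ‖cq q x - q.totient * I‖ ≤ 2 ^ #q.primeFactors * K := by
  have h := norm_sum_sifted_le
    (F := fun t => Complex.exp (t * (2 * Real.pi * Complex.I * x)) - I) (K := K)
    (fun n hn => by
      convert! hK n hn using 5
      push_cast
      ring_nf) q.primeFactors (fun p hp => Nat.prime_of_mem_primeFactors hp) q hq
    (fun p hp => Nat.dvd_of_mem_primeFactors hp)
  have hset : ((Icc 1 q).filter fun k => ∀ p ∈ q.primeFactors, ¬ p ∣ k)
      = (Icc 1 q).filter fun k => Nat.gcd k q = 1 := by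
    refine filter_congr fun k _ => ?_
    constructor
    · intro hk
      refine Nat.coprime_of_dvd fun p hp hpk hpq => hk p ?_ hpk
      exact Nat.mem_primeFactors.mpr ⟨hp, hpq, hq.ne'⟩
    · intro hk p hp hpk
      exact (Nat.prime_of_mem_primeFactors hp).one_lt.ne'
        (Nat.eq_one_of_dvd_coprimes hk hpk (Nat.dvd_of_mem_primeFactors hp))
  have hcard : #((Icc 1 q).filter fun k => Nat.gcd k q = 1) = q.totient := by
    rw [← Nat.filter_coprime_Ico_eq_totient q 1, add_comm 1 q]
    refine congrArg card (ext fun k => ?_)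
    simp only [mem_filter, mem_Icc, mem_Ico, Nat.lt_succ_iff, Nat.coprime_comm (m := q)]
  rw [hset, sum_sub_distrib, sum_const, hcard, nsmul_eq_mul] at h
  convert! h using 3
  refine sum_congr rfl fun k _ => ?_
  congr 1
  push_cast
  ring

theorem pow_card_primeFactors_le (B : ℕ) (hB : 0 < B) {n : ℕ} (hn : n ≠ 0) :
    B ^ #n.primeFactors ≤ B ^ B * n := by
  rw [← card_filter_add_card_filter_not (s := n.primeFactors) (fun p => p < B), pow_add]
  refine Nat.mul_le_mul (Nat.pow_le_pow_right hB ?_) ?_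
  · calc #(n.primeFactors.filter fun p => p < B) ≤ #(range B) :=
        card_le_card fun p hp => by simpa using (mem_filter.mp hp).2
      _ = B := card_range B
  · calc B ^ #(n.primeFactors.filter fun p => ¬ p < B)
        ≤ ∏ p ∈ n.primeFactors.filter fun p => ¬ p < B, p :=
          pow_card_le_prod _ _ _ fun p hp => not_lt.mp (mem_filter.mp hp).2
      _ ≤ ∏ p ∈ n.primeFactors, p := prod_le_prod_of_subset_of_one_le' (filter_subset _ _)
          fun p hp _ => (Nat.prime_of_mem_primeFactors hp).one_le
      _ ≤ n := Nat.le_of_dvd (Nat.pos_of_ne_zero hn) n.prod_primeFactors_dvd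

theorem le_totient_mul_two_pow (n : ℕ) : n ≤ n.totient * 2 ^ #n.primeFactors := by
  have h0 : 0 < ∏ p ∈ n.primeFactors, p :=
    prod_pos fun p hp => (Nat.prime_of_mem_primeFactors hp).pos
  refine Nat.le_of_mul_le_mul_right ?_ h0
  calc n * ∏ p ∈ n.primeFactors, p ≤ n * ∏ p ∈ n.primeFactors, (p - 1) * 2 := by
        refine Nat.mul_le_mul_left _ (prod_le_prod' fun p hp => ?_)
        have := (Nat.prime_of_mem_primeFactors hp).two_le
        omega
    _ = n.totient * 2 ^ #n.primeFactors * ∏ p ∈ n.primeFactors, p := by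
        rw [prod_mul_distrib, prod_const, ← mul_assoc, ← Nat.totient_mul_prod_primeFactors]
        ring

theorem eventually_mul_two_pow_le_totient (A : ℝ) :
    ∀ᶠ q : ℕ in atTop, A * 2 ^ #q.primeFactors ≤ q.totient := by
  have h := tendsto_natCast_atTop_atTop (R := ℝ) |>.eventually_ge_atTop (A ^ 2 * 16 ^ 16)
  filter_upwards [h, eventually_gt_atTop 0] with q hq hq0
  have hq0' : (0 : ℝ) < q := by exact_mod_cast hq0
  set w := #q.primeFactors
  have h1 : (16 : ℝ) ^ w ≤ 16 ^ 16 * q := by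
    exact_mod_cast pow_card_primeFactors_le 16 (by norm_num) hq0.ne'
  have h2 : (q : ℝ) ≤ q.totient * 2 ^ w := by exact_mod_cast le_totient_mul_two_pow q
  have h3 : A * 4 ^ w ≤ q := by
    refine le_of_sq_le_sq ?_ hq0'.le
    calc (A * 4 ^ w) ^ 2 = A ^ 2 * 16 ^ w := by
          rw [mul_pow, ← pow_mul, mul_comm w, pow_mul]; norm_num
      _ ≤ A ^ 2 * (16 ^ 16 * q) := by gcongr
      _ = (A ^ 2 * 16 ^ 16) * q := by ring
      _ ≤ q * q := by gcongr
      _ = (q : ℝ) ^ 2 := by ring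
  have h4 : (4 : ℝ) ^ w = 2 ^ w * 2 ^ w := by rw [← mul_pow]; norm_num
  refine le_of_mul_le_mul_right ?_ (show (0 : ℝ) < 2 ^ w by positivity)
  linarith [h4 ▸ h3, mul_assoc A ((2 : ℝ) ^ w) (2 ^ w)]

theorem not_summable_mul_totient {f : ℕ → ℝ} {C : ℝ} (hC : 0 < C) {Q₀ : ℕ}
    (hf : ∀ q, 0 ≤ f q) (hlb : ∀ q, Q₀ ≤ q → C / (q : ℝ) ^ 2 ≤ f q) :
    ¬ Summable fun q : ℕ => f q * q.totient := by
  intro hs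
  refine not_summable_one_div_on_primes ?_
  refine Summable.of_norm_bounded_eventually_nat (hs.mul_left (2 / C)) ?_
  filter_upwards [eventually_ge_atTop Q₀] with q hq
  by_cases hp : q.Prime
  · have h2 : (2 : ℝ) ≤ q := by exact_mod_cast hp.two_le
    have hmem : q ∈ {p : ℕ | p.Prime} := hp
    rw [Set.indicator_of_mem hmem, Nat.totient_prime hp, Nat.cast_sub hp.one_le, Nat.cast_one,
      Real.norm_of_nonneg (by positivity)]
    calc 1 / (q : ℝ) = 2 / C * (C / (q : ℝ) ^ 2 * (q / 2)) := by field_simp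
      _ ≤ 2 / C * (f q * (q - 1)) := by
        have := hlb q hq
        have := hf q
        gcongr
        linarith
  · have hmem : q ∉ {p : ℕ | p.Prime} := hp
    rw [Set.indicator_of_notMem hmem, norm_zero]
    have := hf q
    positivity

theorem exists_eventually_mul_totient_le_re {x : ℝ} (hx : ∀ n : ℤ, x ≠ n) :
    ∃ w : ℂ, ∃ c : ℝ, 0 < c ∧ ∀ᶠ q : ℕ in atTop, c * q.totient ≤ (w * cq q x).re := by
  set a : ℂ := 2 * Real.pi * Complex.I * x with ha
  have hx0 : x ≠ 0 := by simpa using hx 0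
  have ha0 : a ≠ 0 := by simp [ha, hx0, Real.pi_ne_zero]
  have hexp : Complex.exp a ≠ 1 := by
    rw [Ne, Complex.exp_eq_one_iff]
    rintro ⟨n, hn⟩
    refine hx n ?_
    have : (x : ℂ) = n := by
      refine mul_left_cancel₀ Complex.two_pi_I_ne_zero ?_
      rw [← ha, hn, mul_comm]
    exact_mod_cast this
  obtain ⟨K, hK0, hK⟩ := exists_norm_sum_exp_sub_le ha0 (by simp [ha])
  set I : ℂ := (Complex.exp a - 1) / a with hI
  have hI0 : 0 < ‖I‖ := norm_pos_iff.mpr (div_ne_zero (sub_ne_zero.mpr hexp) ha0)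
  refine ⟨starRingEnd ℂ I, ‖I‖ ^ 2 / 2, by positivity, ?_⟩
  filter_upwards [eventually_mul_two_pow_le_totient (2 * K / ‖I‖), eventually_gt_atTop 0]
    with q hq hq0
  have h1 := norm_cq_sub_le hK hq0
  have h2 : starRingEnd ℂ I * cq q x
      = ((q.totient * ‖I‖ ^ 2 : ℝ) : ℂ) + starRingEnd ℂ I * (cq q x - q.totient * I) := by
    push_cast
    rw [← Complex.conj_mul']
    ring
  have h3 : ‖starRingEnd ℂ I * (cq q x - q.totient * I)‖ ≤ ‖I‖ * (2 ^ #q.primeFactors * K) := by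
    rw [norm_mul, RCLike.norm_conj]
    gcongr
  have h4 := (abs_le.mp ((Complex.abs_re_le_norm _).trans h3)).1
  have h5 : ‖I‖ * (2 ^ #q.primeFactors * K) ≤ ‖I‖ ^ 2 / 2 * q.totient := by
    calc ‖I‖ * (2 ^ #q.primeFactors * K)
        = ‖I‖ ^ 2 / 2 * (2 * K / ‖I‖ * 2 ^ #q.primeFactors) := by field_simp
      _ ≤ _ := by gcongr
  rw [h2, Complex.add_re, Complex.ofReal_re]
  linarith

theorem not_bounded_sum_mul_cq {f : ℕ → ℝ} (hf : ∀ q, 0 ≤ f q) {C : ℝ} (hC : 0 < C) {Q₀ : ℕ}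
    (hlb : ∀ q, Q₀ ≤ q → C / (q : ℝ) ^ 2 ≤ f q) {x : ℝ} (hx : ∀ n : ℤ, x ≠ n) :
    ¬ ∃ M : ℝ, ∀ Q : ℕ, ‖∑ q ∈ Icc 1 Q, (f q : ℂ) * cq q x‖ ≤ M := by
  rintro ⟨M, hM⟩
  obtain ⟨w, c, hc, hev⟩ := exists_eventually_mul_totient_le_re hx
  obtain ⟨N, hN⟩ := eventually_atTop.mp hev
  refine not_summable_mul_totient hC hf hlb ?_
  set g : ℕ → ℝ := fun q => (w * ((f q : ℂ) * cq q x)).re with hg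
  have hgle : ∀ q, N ≤ q → c * (f q * q.totient) ≤ g q := fun q hq => by
    have : g q = f q * (w * cq q x).re := by
      rw [hg, ← Complex.re_ofReal_mul]
      ring_nf
    rw [this]
    nlinarith [mul_le_mul_of_nonneg_left (hN q hq) (hf q)]
  have hgsum : ∀ Q, ∑ q ∈ Icc 1 Q, g q ≤ ‖w‖ * M := fun Q => by
    rw [hg, ← Complex.re_sum, ← mul_sum]
    refine (Complex.re_le_norm _).trans ?_
    rw [norm_mul]
    exact mul_le_mul_of_nonneg_left (hM Q) (norm_nonneg _)
  rw [← summable_nat_add_iff (N + 1)]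
  have hbound : ∀ n, ∑ i ∈ range n, c * (f (i + (N + 1)) * (i + (N + 1)).totient)
      ≤ ‖w‖ * M - ∑ q ∈ Icc 1 N, g q := fun n => by
    have h1 : ∑ q ∈ Icc 1 (N + n), g q
        = ∑ q ∈ Icc 1 N, g q + ∑ i ∈ range n, g (i + (N + 1)) := by
      induction n with
      | zero => simp
      | succ n ih =>
        rw [← add_assoc, sum_Icc_succ_top (by omega), ih, sum_range_succ, add_assoc,
          show n + (N + 1) = N + n + 1 by ring]
    have h2 : ∑ i ∈ range n, c * (f (i + (N + 1)) * (i + (N + 1)).totient)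
        ≤ ∑ i ∈ range n, g (i + (N + 1)) := sum_le_sum fun i _ => hgle _ (by omega)
    linarith [hgsum (N + n)]
  refine (summable_mul_left_iff hc.ne').mp (summable_of_sum_range_le (fun i => ?_) hbound)
  have := hf (i + (N + 1))
  positivity

/-- Let `f̂ : ℕ → ℝ` be nonnegative with `f̂(q) ≥ C/q²` for all `q ≥ Q₀`, for some constant
`C > 0` and positive integer `Q₀`. Then for every real `x ∉ ℤ`, the partial sums
`∑_{q=1}^{Q} f̂(q)·c_q(x)` are unbounded in absolute value; in particular the series
`∑_{q≥1} f̂(q) c_q(x)` diverges. -/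
theorem stmt15 (f : ℕ → ℝ) (hf : ∀ q, 0 ≤ f q) (C : ℝ) (hC : 0 < C) (Q₀ : ℕ)
    (hQ₀ : 0 < Q₀) (hlb : ∀ q, Q₀ ≤ q → C / (q : ℝ) ^ 2 ≤ f q)
    (x : ℝ) (hx : ∀ n : ℤ, x ≠ n) :
    (¬ ∃ M : ℝ, ∀ Q : ℕ, ‖∑ q ∈ Finset.Icc 1 Q, (f q : ℂ) * cq q x‖ ≤ M) ∧
    ¬ ∃ L : ℂ, Filter.Tendsto (fun Q : ℕ => ∑ q ∈ Finset.Icc 1 Q, (f q : ℂ) * cq q x)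
      Filter.atTop (nhds L) := by
  have hub := not_bounded_sum_mul_cq hf hC hlb hx
  refine ⟨hub, ?_⟩
  rintro ⟨L, hL⟩
  obtain ⟨M, hM⟩ := (Metric.isBounded_range_of_tendsto _ hL).exists_norm_le
  exact hub ⟨M, fun Q => hM _ (Set.mem_range_self Q)⟩
end
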